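/- arXiv:2005.01076 — 2 statements merged into one kernel-verified Lean document; each statement's English description precedes it below -/
import Mathlib

section
/- Let q and γ be complex numbers with q ≠ 0, γ ≠ 0, and |γ + q| ≠ |γ| (equivalently, |x| ≠ 1 for x = 1 + q/γ). Then there exists a positive integer c with the following property: for every natural number n, every positive integer m, every family l : Fin m → ℕ of positive integers, and every complex number γ̂ with |γ − γ̂| ≤ 2^{−(n + c·(m + ∑_j l(j)))}, setting x = 1 + q/γ and x̂ = 1 + q/γ̂, one has |∏_{j} (1 + q/(x^{l(j)} − 1)) − ∏_{j} (1 + q/(x̂^{l(j)} − 1))| ≤ 2^{−n}. -/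
lemma aux_prod {ι : Type*} (s : Finset ι) (a b : ι → ℂ) (M D : ℝ) (hM : 1 ≤ M) (hD : 0 ≤ D)
    (ha : ∀ i, ‖a i‖ ≤ M) (hb : ∀ i, ‖b i‖ ≤ M) (hab : ∀ i, ‖a i - b i‖ ≤ D) :
    ‖∏ i ∈ s, a i - ∏ i ∈ s, b i‖ ≤ (2 * M) ^ s.card * D := by
  classical
  induction s using Finset.induction_on with
  | empty => simpa using hD
  | insert i s hi ih =>
    rw [Finset.prod_insert hi, Finset.prod_insert hi, Finset.card_insert_of_notMem hi]
    have h1 : ‖∏ i ∈ s, b i‖ ≤ (2 * M) ^ s.card := by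
      rw [norm_prod]
      calc ∏ i ∈ s, ‖b i‖ ≤ ∏ i ∈ s, (2 * M) :=
            Finset.prod_le_prod (fun _ _ => norm_nonneg _) (fun j _ => by linarith [hb j])
        _ = _ := by simp
    have h2 : a i * ∏ i ∈ s, a i - b i * ∏ i ∈ s, b i
        = a i * (∏ i ∈ s, a i - ∏ i ∈ s, b i) + (a i - b i) * ∏ i ∈ s, b i := by ring
    rw [h2]
    have hP : 0 ≤ (2 * M) ^ s.card := by positivity
    calc _ ≤ ‖a i‖ * ‖∏ i ∈ s, a i - ∏ i ∈ s, b i‖ + ‖a i - b i‖ * ‖∏ i ∈ s, b i‖ := by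
          refine (norm_add_le _ _).trans ?_
          rw [norm_mul, norm_mul]
      _ ≤ M * ((2 * M) ^ s.card * D) + D * (2 * M) ^ s.card := by
          gcongr
          · exact ha i
          · exact hab i
      _ ≤ (2 * M) ^ (s.card + 1) * D := by
          rw [pow_succ]
          nlinarith [mul_nonneg hP hD]

lemma aux_low (z : ℂ) (l : ℕ) (hl : 0 < l) : |‖z‖ - 1| ≤ ‖z ^ l - 1‖ := by
  have h : |‖z‖ ^ l - 1| ≤ ‖z ^ l - 1‖ := by
    simpa using abs_norm_sub_norm_le (z ^ l) 1
  refine le_trans ?_ h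
  have h0 := norm_nonneg z
  rcases le_total ‖z‖ 1 with h1 | h1
  · have := pow_le_of_le_one h0 h1 hl.ne'
    rw [abs_of_nonpos (by linarith), abs_of_nonpos (by linarith)]
    linarith
  · have := le_self_pow₀ h1 hl.ne'
    rw [abs_of_nonneg (by linarith), abs_of_nonneg (by linarith)]
    linarith

lemma aux_diff (q x y : ℂ) (l : ℕ) (hl : 0 < l) (δ R : ℝ) (hδ : 0 < δ) (hR : 1 ≤ R)
    (hx : ‖x‖ ≤ R) (hy : ‖y‖ ≤ R) (hx1 : δ ≤ |‖x‖ - 1|) (hy1 : δ ≤ |‖y‖ - 1|) :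
    ‖(1 + q / (x ^ l - 1)) - (1 + q / (y ^ l - 1))‖ ≤ ‖q‖ / δ ^ 2 * (2 * R) ^ l * ‖x - y‖ := by
  have hX := hx1.trans (aux_low x l hl)
  have hY := hy1.trans (aux_low y l hl)
  have hX0 : x ^ l - 1 ≠ 0 := norm_pos_iff.1 (hδ.trans_le hX)
  have hY0 : y ^ l - 1 ≠ 0 := norm_pos_iff.1 (hδ.trans_le hY)
  have e : (1 + q / (x ^ l - 1)) - (1 + q / (y ^ l - 1))
      = q * (y ^ l - x ^ l) / ((x ^ l - 1) * (y ^ l - 1)) := by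
    field_simp
    ring
  have hp : ‖y ^ l - x ^ l‖ ≤ (2 * R) ^ l * ‖x - y‖ := by
    have := aux_prod (Finset.range l) (fun _ => y) (fun _ => x) R ‖x - y‖ hR (norm_nonneg _)
      (fun _ => hy) (fun _ => hx) (fun _ => (norm_sub_rev y x).le)
    simpa using this
  rw [e, norm_div, norm_mul, norm_mul]
  calc _ ≤ ‖q‖ * ((2 * R) ^ l * ‖x - y‖) / (δ * δ) := by gcongr
    _ = _ := by field_simp

lemma aux_bd (q x : ℂ) (l : ℕ) (hl : 0 < l) (δ : ℝ) (hδ : 0 < δ) (hx1 : δ ≤ |‖x‖ - 1|) :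
    ‖1 + q / (x ^ l - 1)‖ ≤ 1 + ‖q‖ / δ := by
  have hX := hx1.trans (aux_low x l hl)
  refine (norm_add_le _ _).trans ?_
  rw [norm_one, norm_div]
  gcongr


/-- Lemma 4.5: for `q ≠ 0`, `γ ≠ 0` with `|γ + q| ≠ |γ|`, there is a constant `c`
such that approximating `γ` to precision `2^{-(n + c(m + Σ l_j))}` yields an
approximation of the theta-graph weight product to precision `2^{-n}`. -/
theorem stmt_3 (q γ : ℂ) (hq : q ≠ 0) (hγ : γ ≠ 0)
    (habs : ‖γ + q‖ ≠ ‖γ‖) :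
    ∃ c : ℕ, 0 < c ∧
      ∀ (n m : ℕ), 0 < m → ∀ l : Fin m → ℕ, (∀ j, 0 < l j) →
        ∀ γhat : ℂ,
          ‖γ - γhat‖ ≤
              (2 : ℝ) ^ (-((n + c * (m + ∑ j, l j) : ℕ) : ℤ)) →
          ‖(∏ j, (1 + q / ((1 + q / γ) ^ (l j) - 1))) -
              ∏ j, (1 + q / ((1 + q / γhat) ^ (l j) - 1))‖ ≤ (2 : ℝ) ^ (-(n : ℤ)) := by
  have hg : 0 < ‖γ‖ := norm_pos_iff.2 hγ
  have hq0 : 0 < ‖q‖ := norm_pos_iff.2 hq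
  set x : ℂ := 1 + q / γ with hxdef
  have hx1 : ‖x‖ ≠ 1 := by
    intro h
    apply habs
    have : γ + q = γ * x := by rw [hxdef]; field_simp
    rw [this, norm_mul, h, mul_one]
  obtain ⟨δ, hδ, hδx⟩ : ∃ δ : ℝ, 0 < δ ∧ 2 * δ = |‖x‖ - 1| :=
    ⟨|‖x‖ - 1| / 2, half_pos (abs_pos.2 (sub_ne_zero.2 hx1)), by ring⟩
  obtain ⟨L, hL, hL'⟩ : ∃ L : ℝ, 0 < L ∧ L = 2 * ‖q‖ / ‖γ‖ ^ 2 := ⟨_, by positivity, rfl⟩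
  set R : ℝ := 1 + ‖x‖ + δ with hR
  set M : ℝ := 1 + ‖q‖ / δ with hM
  set A : ℝ := ‖q‖ / δ ^ 2 * L with hA
  have hR1 : 1 ≤ R := by have := norm_nonneg x; linarith
  have hM1 : 1 ≤ M := by have : 0 < ‖q‖ / δ := by positivity
                         linarith
  have hA0 : 0 < A := by positivity
  set T : ℝ := A + 2 * M + 2 * R with hT
  obtain ⟨c, hc⟩ := pow_unbounded_of_one_lt (T ^ 2 + 2 / ‖γ‖ + L / δ) (one_lt_two (α := ℝ))
  have p1 : 0 < 2 / ‖γ‖ := by positivity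
  have p2 : 0 < L / δ := by positivity
  have hT1 : 1 ≤ T := by linarith
  have hT2 : 1 ≤ T ^ 2 := one_le_pow₀ hT1
  have hc0 : 0 < c := by
    rcases Nat.eq_zero_or_pos c with h | h
    · subst h
      norm_num at hc
      linarith
    · exact h
  refine ⟨c, hc0, ?_⟩
  intro n m hm l hl g hε
  set S : ℕ := ∑ j, l j with hS
  set ε : ℝ := ‖γ - g‖ with hεd
  have hε0 : 0 ≤ ε := norm_nonneg _
  rw [zpow_neg, zpow_natCast] at hε
  rw [zpow_neg, zpow_natCast]
  have hεc : ε * 2 ^ c ≤ 1 := by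
    have : ((2 : ℝ) ^ (n + c * (m + S)))⁻¹ ≤ (2 ^ c)⁻¹ := by
      gcongr
      · norm_num
      · nlinarith
    have h3 := hε.trans this
    rwa [← one_div, le_div_iff₀ (by positivity)] at h3
  have e1 : ε ≤ ‖γ‖ / 2 := by
    have : ε * (2 / ‖γ‖) ≤ 1 := le_trans (by gcongr; linarith) hεc
    field_simp at this
    linarith
  have e2 : L * ε ≤ δ := by
    have : ε * (L / δ) ≤ 1 := le_trans (by gcongr; linarith) hεc
    field_simp at this
    linarith
  have hgh : ‖γ‖ / 2 ≤ ‖g‖ := by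
    have := norm_sub_norm_le γ g
    linarith
  have hg0 : g ≠ 0 := norm_pos_iff.1 (by linarith)
  set y : ℂ := 1 + q / g with hy
  have hxy : ‖x - y‖ ≤ L * ε := by
    have e : x - y = q * (g - γ) / (γ * g) := by
      rw [hxdef, hy]; field_simp; ring
    rw [e, norm_div, norm_mul, norm_mul, norm_sub_rev, ← hεd]
    calc _ ≤ ‖q‖ * ε / (‖γ‖ * (‖γ‖ / 2)) := by gcongr
      _ = _ := by rw [hL']; field_simp
  have hyx : |‖x‖ - ‖y‖| ≤ δ := (abs_norm_sub_norm_le x y).trans (hxy.trans e2)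
  have hyδ : δ ≤ |‖y‖ - 1| := by
    have := abs_sub_le ‖x‖ ‖y‖ 1
    linarith
  have hxδ : δ ≤ |‖x‖ - 1| := by linarith
  have hyR : ‖y‖ ≤ R := by have := abs_le.1 hyx; linarith
  have hxR : ‖x‖ ≤ R := by linarith
  have key := aux_prod Finset.univ (fun j => 1 + q / (x ^ (l j) - 1))
    (fun j => 1 + q / (y ^ (l j) - 1)) M (A * (2 * R) ^ S * ε) hM1 (by positivity)
    (fun j => aux_bd q x _ (hl j) δ hδ hxδ) (fun j => aux_bd q y _ (hl j) δ hδ hyδ)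
    (fun j => by
      refine (aux_diff q x y _ (hl j) δ R hδ hR1 hxR hyR hxδ hyδ).trans ?_
      have hj : l j ≤ S := Finset.single_le_sum (fun _ _ => Nat.zero_le _) (Finset.mem_univ j)
      calc ‖q‖ / δ ^ 2 * (2 * R) ^ l j * ‖x - y‖ ≤ ‖q‖ / δ ^ 2 * (2 * R) ^ S * (L * ε) := by
            gcongr
            linarith
        _ = _ := by rw [hA]; ring)
  refine key.trans ?_
  rw [Finset.card_univ, Fintype.card_fin]
  calc (2 * M) ^ m * (A * (2 * R) ^ S * ε) ≤ T ^ m * (T * T ^ S * ε) := by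
        gcongr <;> linarith
    _ = T ^ (m + 1 + S) * ε := by ring
    _ ≤ T ^ (2 * (m + S)) * ε := by
        gcongr
        · omega
    _ = (T ^ 2) ^ (m + S) * ε := by rw [pow_mul]
    _ ≤ (2 ^ c) ^ (m + S) * ((2 : ℝ) ^ (n + c * (m + S)))⁻¹ := by
        gcongr
        linarith
    _ = (2 ^ n)⁻¹ := by
        rw [← pow_mul, pow_add]
        field_simp
end

section
/- Let q and γ be real numbers with q ∉ {0, 1} and γ > 0. Let a multigraph on Fin n with edges Fin m be given, and let s and t be two distinct vertices that are connected in the multigraph. Set c = 2·max(|q|, 1/|q|)·max(γ, 1/γ) and r = max(n, m). Define B = Z_{s|t}(q, γ)·(1 − 1/q) and A = −(Z_{st}(q, γ) + Z_{s|t}(q, γ)/q). Assume |Z_{st}(q, γ)| ≥ c^{−r}, |Z_{s|t}(q, γ)| ≥ c^{−r}, and A ≠ 0, and let ε* = B/A be the zero of the linear function ε ↦ B − εA. Then |1 − q − ε*| ≥ |1 − q|·c^{−2r} and |ε*| ≥ |1 − 1/q|·c^{−2r}. -/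
open scoped Classical

/-- Number of connected components of the simple graph on `Fin n` determined by
the edge subset `A` of a multigraph given by `ends : Fin m → Sym2 (Fin n)`. -/
noncomputable def numComponents {n m : ℕ} (ends : Fin m → Sym2 (Fin n))
    (A : Finset (Fin m)) : ℕ :=
  Nat.card (SimpleGraph.fromEdgeSet
    ((A.image ends : Finset (Sym2 (Fin n))) : Set (Sym2 (Fin n)))).ConnectedComponent

/-- The random-cluster Tutte partition function `Z(q, γ)` of a multigraph. -/
noncomputable def tutteZ {K : Type*} [Field K] {n m : ℕ}
    (ends : Fin m → Sym2 (Fin n)) (q γ : K) : K :=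
  ∑ A : Finset (Fin m), q ^ numComponents ends A * γ ^ A.card

/-- The contribution `Z_{st}(q, γ)` from edge subsets where `s` and `t` lie in
the same connected component. -/
noncomputable def tutteZst {K : Type*} [Field K] {n m : ℕ}
    (ends : Fin m → Sym2 (Fin n)) (q γ : K) (s t : Fin n) : K :=
  ∑ A : Finset (Fin m),
    if (SimpleGraph.fromEdgeSet
        ((A.image ends : Finset (Sym2 (Fin n))) : Set (Sym2 (Fin n)))).Reachable s t
    then q ^ numComponents ends A * γ ^ A.card else 0

/-- The contribution `Z_{s|t}(q, γ) = Z(q, γ) - Z_{st}(q, γ)` from edge subsets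
where `s` and `t` lie in different connected components. -/
noncomputable def tutteZsplit {K : Type*} [Field K] {n m : ℕ}
    (ends : Fin m → Sym2 (Fin n)) (q γ : K) (s t : Fin n) : K :=
  tutteZ ends q γ - tutteZst ends q γ s t

lemma numComponents_le {n m : ℕ} (ends : Fin m → Sym2 (Fin n)) (A : Finset (Fin m)) :
    numComponents ends A ≤ n := by
  unfold numComponents
  have h := Nat.card_le_card_of_surjective
    (SimpleGraph.fromEdgeSet
      ((A.image ends : Finset (Sym2 (Fin n))) : Set (Sym2 (Fin n)))).connectedComponentMk
    (fun x => by
      induction x using SimpleGraph.ConnectedComponent.ind with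
      | _ v => exact ⟨v, rfl⟩)
  simpa using h

lemma numComponents_pos {n m : ℕ} (ends : Fin m → Sym2 (Fin n)) (A : Finset (Fin m))
    (s : Fin n) : 0 < numComponents ends A := by
  unfold numComponents
  haveI : Nonempty (SimpleGraph.fromEdgeSet
    ((A.image ends : Finset (Sym2 (Fin n))) : Set (Sym2 (Fin n)))).ConnectedComponent :=
    ⟨SimpleGraph.connectedComponentMk _ s⟩
  exact Nat.card_pos

lemma one_le_max_inv {x : ℝ} (hx : 0 < x) : 1 ≤ max x (1 / x) := by
  rcases le_total 1 x with h | h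
  · exact le_max_of_le_left h
  · exact le_max_of_le_right (by rw [le_div_iff₀ hx]; linarith)

lemma pow_abs_bound (q : ℝ) (hq : q ≠ 0) {k r : ℕ} (h : k ≤ r) :
    |q ^ k| ≤ max |q| (1 / |q|) ^ r := by
  rw [abs_pow]
  calc |q| ^ k ≤ max |q| (1 / |q|) ^ k := by
        gcongr
        exact le_max_left _ _
    _ ≤ _ := pow_le_pow_right₀ (one_le_max_inv (abs_pos.mpr hq)) h

lemma A_bound (q γ : ℝ) (hq0 : q ≠ 0) (hγ : 0 < γ)
    (n m : ℕ) (ends : Fin m → Sym2 (Fin n)) (s t : Fin n) (r : ℕ) (hr : r = max n m) :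
    |tutteZst ends q γ s t + tutteZsplit ends q γ s t / q| ≤
      (2 * max |q| (1 / |q|) * max γ (1 / γ)) ^ r := by
  have hn : n ≤ r := hr ▸ le_max_left _ _
  have hm : m ≤ r := hr ▸ le_max_right _ _
  have e : tutteZst ends q γ s t + tutteZsplit ends q γ s t / q =
      ∑ A : Finset (Fin m), if (SimpleGraph.fromEdgeSet
        ((A.image ends : Finset (Sym2 (Fin n))) : Set (Sym2 (Fin n)))).Reachable s t
        then q ^ numComponents ends A * γ ^ A.card
        else q ^ (numComponents ends A - 1) * γ ^ A.card := by
    unfold tutteZsplit tutteZ tutteZst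
    rw [← Finset.sum_sub_distrib, Finset.sum_div, ← Finset.sum_add_distrib]
    refine Finset.sum_congr rfl fun A _ => ?_
    split_ifs
    · simp
    · obtain ⟨k, hk⟩ := Nat.exists_eq_succ_of_ne_zero (numComponents_pos ends A s).ne'
      rw [hk]
      simp only [Nat.succ_eq_add_one, Nat.add_sub_cancel, pow_succ]
      field_simp
      ring
  have hM := one_le_max_inv (abs_pos.mpr hq0)
  have hG := one_le_max_inv hγ
  have key : ∀ (k : ℕ) (A : Finset (Fin m)), k ≤ n → |q ^ k * γ ^ A.card| ≤
      max |q| (1 / |q|) ^ r * max γ (1 / γ) ^ r := by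
    intro k A hk
    rw [abs_mul]
    have h1 := pow_abs_bound q hq0 (hk.trans hn)
    have h2 := pow_abs_bound γ hγ.ne' (k := A.card) (r := r)
      (le_trans (by simpa using A.card_le_univ) hm)
    rw [abs_of_pos hγ] at h2
    gcongr
  rw [e]
  calc _ ≤ ∑ A : Finset (Fin m), max |q| (1 / |q|) ^ r * max γ (1 / γ) ^ r := by
        refine (Finset.abs_sum_le_sum_abs _ _).trans (Finset.sum_le_sum fun A _ => ?_)
        have := numComponents_le ends A
        split_ifs
        · exact key _ _ this
        · exact key _ _ (by omega)
    _ = 2 ^ m * (max |q| (1 / |q|) ^ r * max γ (1 / γ) ^ r) := by simp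
    _ ≤ 2 ^ r * (max |q| (1 / |q|) ^ r * max γ (1 / γ) ^ r) := by
        gcongr
        norm_num
    _ = _ := by rw [mul_pow, mul_pow, mul_assoc]

/-- Lemma 6.7: bounds keeping the zero `ε* = B/A` of the linear function
`ε ↦ B - εA` away from the endpoints `1 - q` and `0`. -/
theorem stmt_12 (q γ : ℝ) (hq0 : q ≠ 0) (hq1 : q ≠ 1) (hγ : 0 < γ)
    (n m : ℕ) (ends : Fin m → Sym2 (Fin n)) (s t : Fin n) (hst : s ≠ t)
    (hconn : (SimpleGraph.fromEdgeSet
        (((Finset.univ.image ends : Finset (Sym2 (Fin n)))) : Set (Sym2 (Fin n)))).Reachable s t)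
    (c : ℝ) (hc : c = 2 * max |q| (1 / |q|) * max γ (1 / γ))
    (r : ℕ) (hr : r = max n m)
    (B A : ℝ)
    (hB : B = tutteZsplit ends q γ s t * (1 - 1 / q))
    (hA : A = -(tutteZst ends q γ s t + tutteZsplit ends q γ s t / q))
    (hZst : c ^ (-(r : ℤ)) ≤ |tutteZst ends q γ s t|)
    (hZsplit : c ^ (-(r : ℤ)) ≤ |tutteZsplit ends q γ s t|)
    (hAne : A ≠ 0)
    (ε : ℝ) (hε : ε = B / A) :
    |1 - q| * c ^ (-(2 * (r : ℤ))) ≤ |1 - q - ε| ∧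
    |1 - 1 / q| * c ^ (-(2 * (r : ℤ))) ≤ |ε| := by
  have hAb : |A| ≤ c ^ r := by
    rw [hA, abs_neg, hc]
    exact A_bound q γ hq0 hγ n m ends s t r hr
  have hApos : 0 < |A| := abs_pos.mpr hAne
  have hcr : 0 < c ^ r := hApos.trans_le hAb
  have hpow : c ^ (-(2 * (r : ℤ))) = (c ^ r)⁻¹ * (c ^ r)⁻¹ := by
    rw [zpow_neg, mul_comm, zpow_mul, zpow_natCast, ← mul_inv]
    congr 1
    exact (pow_two _)
  have hneg : c ^ (-(r : ℤ)) = (c ^ r)⁻¹ := by rw [zpow_neg, zpow_natCast]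
  rw [hneg] at hZst hZsplit
  have gen : ∀ x z : ℝ, (c ^ r)⁻¹ ≤ |z| → |x| * ((c ^ r)⁻¹ * (c ^ r)⁻¹) ≤ |x * (z / A)| := by
    intro x z hz
    rw [abs_mul, abs_div, div_eq_mul_inv]
    gcongr
  have e1 : 1 - q - ε = (1 - q) * (-tutteZst ends q γ s t / A) := by
    have : (1 - q) * A - B = (1 - q) * (-tutteZst ends q γ s t) := by
      rw [hA, hB]; field_simp; ring
    rw [← mul_div_assoc, ← this, hε]
    field_simp
  have e2 : ε = (1 - 1 / q) * (tutteZsplit ends q γ s t / A) := by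
    rw [hε, hB]; ring
  rw [hpow]
  constructor
  · rw [e1]
    exact gen _ _ (by rwa [abs_neg])
  · rw [e2]
    exact gen _ _ hZsplit
end
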